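/- Let n be a positive integer, a ∈ (0,2), b > 0 with a + b < n, γ := (n+b−a)/2, and α_{a,n} := 2^{a−1} π^{−n/2} Γ((n+a)/2)/|Γ(−a/2)|. Then for every smooth compactly supported ψ : ℝⁿ → ℂ the ground state representation of |q|^{b/2}|p|^a|q|^{b/2} holds: α_{a,n} ∫∫ ||x|^{b/2}ψ(x) − |y|^{b/2}ψ(y)|² / |x−y|^{n+a} dx dy = 2^a (Γ((n+a)/4)/Γ((n−a)/4))² ∫_{ℝⁿ} |x|^{b−a} |ψ(x)|² dx + α_{a,n} ∫∫ |x|^{b/2}|y|^{b/2} · |ψ(x)|x|^γ − ψ(y)|y|^γ|² / (|x|^γ |x−y|^{n+a} |y|^γ) dx dy. -/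

import Mathlib

open MeasureTheory Real

/-- The constant `α_{a,n} = 2^{a-1} π^{-n/2} Γ((n+a)/2) / |Γ(-a/2)|`. -/
noncomputable def alphaConst (n : ℕ) (a : ℝ) : ℝ :=
  2 ^ (a - 1) * Real.pi ^ (-(n : ℝ) / 2) * Real.Gamma (((n : ℝ) + a) / 2) /
    |Real.Gamma (-a / 2)|

theorem lintegral_rpow_mul_exp_neg_mul {s c : ℝ} (hs : 0 < s) (hc : 0 < c) :
    ∫⁻ t in Set.Ioi (0 : ℝ), ENNReal.ofReal (t ^ (s - 1) * exp (-(c * t))) =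
      ENNReal.ofReal ((1 / c) ^ s * Real.Gamma s) := by
  have h := integral_rpow_mul_exp_neg_mul_Ioi hs hc
  have hG := Real.Gamma_pos_of_pos hs
  rw [← h, ofReal_integral_eq_lintegral_ofReal]
  · exact .of_integral_ne_zero (by rw [h]; positivity)
  · filter_upwards [self_mem_ae_restrict measurableSet_Ioi] with t ht
    have : 0 < t := ht
    positivity

theorem lintegral_exp_neg_mul_sq_norm_mul {n : ℕ} {s t : ℝ} (hs : 0 < s) (ht : 0 ≤ t)
    (x : EuclideanSpace ℝ (Fin n)) :
    ∫⁻ y : EuclideanSpace ℝ (Fin n),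
        ENNReal.ofReal (exp (-(s * ‖y‖ ^ 2)) * exp (-(t * ‖x - y‖ ^ 2))) =
      ENNReal.ofReal ((π / (s + t)) ^ ((n : ℝ) / 2) * exp (-(s * t / (s + t) * ‖x‖ ^ 2))) := by
  have hst : 0 < s + t := by positivity
  have hpt (y : EuclideanSpace ℝ (Fin n)) :
      exp (-(s * ‖y‖ ^ 2)) * exp (-(t * ‖x - y‖ ^ 2)) =
        exp (-(s * t / (s + t) * ‖x‖ ^ 2)) *
          exp (-(s + t) * ‖y - (t / (s + t)) • x‖ ^ 2) := by
    rw [← exp_add, ← exp_add, norm_sub_sq_real, norm_sub_sq_real, norm_smul, inner_smul_right,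
      real_inner_comm, norm_of_nonneg (by positivity)]
    congr 1
    field_simp
    ring
  have h := GaussianFourier.integral_rexp_neg_mul_sq_norm
    (V := EuclideanSpace ℝ (Fin n)) hst
  rw [finrank_euclideanSpace_fin] at h
  have hint : Integrable fun v : EuclideanSpace ℝ (Fin n) ↦ exp (-(s + t) * ‖v‖ ^ 2) :=
    .of_integral_ne_zero (by rw [h]; positivity)
  simp_rw [hpt, ENNReal.ofReal_mul (exp_nonneg _)]
  rw [lintegral_const_mul' _ _ ENNReal.ofReal_ne_top,
    lintegral_sub_right_eq_self (fun y : EuclideanSpace ℝ (Fin n) ↦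
      ENNReal.ofReal (exp (-(s + t) * ‖y‖ ^ 2))),
    ← ofReal_integral_eq_lintegral_ofReal hint (.of_forall fun _ ↦ (exp_pos _).le), h,
    ← ENNReal.ofReal_mul (exp_nonneg _), mul_comm]

theorem lintegral_rpow_mul_exp_neg_parallel {p q t : ℝ} (ht : 0 < t) (c : ℝ) :
    ∫⁻ s in Set.Ioi (0 : ℝ), ENNReal.ofReal
        (s ^ (p - 1) * ((π / (s + t)) ^ (p + q) * exp (-(s * t / (s + t) * c)))) =
      ∫⁻ r in Set.Ioo 0 t, ENNReal.ofReal
        (π ^ (p + q) * t ^ (1 - p - 2 * q) *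
          (r ^ (p - 1) * exp (-(r * c)) * (t - r) ^ (q - 1))) := by
  have himg : (fun r ↦ r * t / (t - r)) '' Set.Ioo 0 t = Set.Ioi 0 := by
    ext s
    constructor
    · rintro ⟨r, ⟨h0, h1⟩, rfl⟩
      have : 0 < t - r := by linarith
      simp only [Set.mem_Ioi]
      positivity
    · intro hs
      have hs' : 0 < s := hs
      refine ⟨s * t / (s + t), ⟨by positivity, ?_⟩, ?_⟩
      · rw [div_lt_iff₀ (by positivity)]; nlinarith
      · have : t - s * t / (s + t) = t ^ 2 / (s + t) := by field_simp; ring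
        simp only [this]
        field_simp
  have hderiv : ∀ r ∈ Set.Ioo 0 t,
      HasDerivWithinAt (fun r ↦ r * t / (t - r)) (t ^ 2 / (t - r) ^ 2) (Set.Ioo 0 t) r := by
    intro r hr
    have hr' : t - r ≠ 0 := by linarith [hr.2]
    have h := ((hasDerivAt_id r).mul_const t).div ((hasDerivAt_id r).const_sub t) hr'
    refine (h.congr_deriv ?_).hasDerivWithinAt
    simp only [id]
    field_simp
    ring
  have hinj : Set.InjOn (fun r ↦ r * t / (t - r)) (Set.Ioo 0 t) := by
    intro r hr r' hr' h
    have h1 : t - r ≠ 0 := by linarith [hr.2]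
    have h2 : t - r' ≠ 0 := by linarith [hr'.2]
    simp only at h
    field_simp at h
    nlinarith
  rw [← himg, lintegral_image_eq_lintegral_abs_deriv_mul measurableSet_Ioo hderiv hinj]
  refine setLIntegral_congr_fun measurableSet_Ioo fun r hr ↦ ?_
  have hr0 : 0 < r := hr.1
  have hr1 : 0 < t - r := by linarith [hr.2]
  rw [← ENNReal.ofReal_mul (abs_nonneg _), abs_of_pos (by positivity)]
  have hsum : r * t / (t - r) + t = t ^ 2 / (t - r) := by field_simp; ring
  have harg : r * t / (t - r) * t / (t ^ 2 / (t - r)) = r := by field_simp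
  rw [hsum, harg, div_div_eq_mul_div, div_rpow (by positivity) hr1.le,
    mul_rpow hr0.le ht.le, div_rpow (by positivity) (by positivity),
    mul_rpow (by positivity) hr1.le]
  congr 1
  have e1 : (t ^ 2) ^ (p + q) = t ^ (p - 1) * t ^ 2 / t ^ (1 - p - 2 * q) := by
    rw [eq_div_iff (by positivity), ← rpow_natCast, ← rpow_mul ht.le, ← rpow_add ht,
      ← rpow_add ht]
    congr 1; push_cast; ring
  have e2 : (t - r) ^ (p + q) = (t - r) ^ (p - 1) * (t - r) ^ 2 * (t - r) ^ (q - 1) := by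
    rw [← rpow_natCast, ← rpow_add hr1, ← rpow_add hr1]
    congr 1; push_cast; ring
  rw [e1, e2]
  field_simp

theorem lintegral_Ioi_one_rpow_mul_sub_one_rpow {p q : ℝ} (hp : 0 < p) (hq : 0 < q)
    (hqp : q < p + 1) :
    ∫⁻ t in Set.Ioi (1 : ℝ), ENNReal.ofReal (t ^ (-p - 1) * (t - 1) ^ (q - 1)) =
      ENNReal.ofReal (Real.Gamma q * Real.Gamma (1 + p - q) / Real.Gamma (p + 1)) := by
  have hΓ := Real.Gamma_pos_of_pos (by linarith : 0 < p + 1)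
  have hΓq := Real.Gamma_pos_of_pos hq
  have hshift (x : ℝ) (hx : 0 < x) :
      ∫⁻ t in Set.Ioi (1 : ℝ), ENNReal.ofReal (exp (-(t * x)) * (t - 1) ^ (q - 1)) =
        ENNReal.ofReal (exp (-x) * ((1 / x) ^ q * Real.Gamma q)) := by
    have himg : (fun t : ℝ ↦ t - 1) ⁻¹' Set.Ioi 0 = Set.Ioi 1 := by ext; simp
    have h := (measurePreserving_sub_right volume (1 : ℝ)).setLIntegral_comp_preimage_emb
      (MeasurableEquiv.subRight (1 : ℝ)).measurableEmbedding
      (fun t ↦ ENNReal.ofReal (t ^ (q - 1) * exp (-(x * t)))) (Set.Ioi 0)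
    rw [ENNReal.ofReal_mul (exp_nonneg _), ← lintegral_rpow_mul_exp_neg_mul hq hx, ← h, himg,
      ← lintegral_const_mul' _ _ ENNReal.ofReal_ne_top]
    refine setLIntegral_congr_fun measurableSet_Ioi fun t _ ↦ ?_
    rw [← ENNReal.ofReal_mul (exp_nonneg _), mul_left_comm, ← exp_add, mul_comm]
    ring_nf
  have hrep (t : ℝ) (ht : t ∈ Set.Ioi (1 : ℝ)) :
      ENNReal.ofReal (t ^ (-p - 1) * (t - 1) ^ (q - 1)) =
        ∫⁻ x in Set.Ioi (0 : ℝ), ENNReal.ofReal (1 / Real.Gamma (p + 1) * x ^ p) *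
          ENNReal.ofReal (exp (-(t * x)) * (t - 1) ^ (q - 1)) := by
    have ht0 : 0 < t := by have : 1 < t := ht; linarith
    have ht1 : 0 < t - 1 := by have : 1 < t := ht; linarith
    have h := lintegral_rpow_mul_exp_neg_mul (by linarith : 0 < p + 1) ht0
    have e : t ^ (-p - 1) * (t - 1) ^ (q - 1) =
        (1 / Real.Gamma (p + 1) * (t - 1) ^ (q - 1)) *
          ((1 / t) ^ (p + 1) * Real.Gamma (p + 1)) := by
      rw [one_div t, inv_rpow ht0.le, ← rpow_neg ht0.le]
      field_simp
      congr 1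
      ring
    rw [e, ENNReal.ofReal_mul (by positivity), ← h,
      ← lintegral_const_mul' _ _ ENNReal.ofReal_ne_top]
    refine setLIntegral_congr_fun measurableSet_Ioi fun x hx ↦ ?_
    have hx' : 0 < x := hx
    rw [← ENNReal.ofReal_mul (by positivity), ← ENNReal.ofReal_mul (by positivity)]
    ring_nf
  rw [setLIntegral_congr_fun measurableSet_Ioi hrep, lintegral_lintegral_swap (by fun_prop)]
  have hin (x : ℝ) (hx : x ∈ Set.Ioi (0 : ℝ)) :
      ∫⁻ t in Set.Ioi (1 : ℝ), ENNReal.ofReal (1 / Real.Gamma (p + 1) * x ^ p) *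
          ENNReal.ofReal (exp (-(t * x)) * (t - 1) ^ (q - 1)) =
        ENNReal.ofReal (Real.Gamma q / Real.Gamma (p + 1)) *
          ENNReal.ofReal (x ^ ((1 + p - q) - 1) * exp (-(1 * x))) := by
    have hx' : 0 < x := hx
    rw [lintegral_const_mul' _ _ ENNReal.ofReal_ne_top, hshift x hx,
      ← ENNReal.ofReal_mul (by positivity), ← ENNReal.ofReal_mul (by positivity)]
    congr 1
    have : x ^ (1 + p - q - 1) = x ^ p * (1 / x) ^ q := by
      rw [one_div, inv_rpow hx'.le, ← rpow_neg hx'.le, ← rpow_add hx']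
      ring_nf
    rw [this]
    ring_nf
  rw [setLIntegral_congr_fun measurableSet_Ioi hin,
    lintegral_const_mul' _ _ ENNReal.ofReal_ne_top,
    lintegral_rpow_mul_exp_neg_mul (by linarith) one_pos, ← ENNReal.ofReal_mul (by positivity)]
  simp
  ring_nf

open Asymptotics Filter Topology in
theorem isBigO_rpow_mul_one_sub_rpow (e s : ℝ) :
    (fun t : ℝ ↦ t ^ e * (1 - (1 - 1 / t) ^ s)) =O[atTop] fun t ↦ t ^ (e - 1) := by
  have h : HasDerivAt (fun u : ℝ ↦ (1 - u) ^ s) (-1 * s * (1 - 0) ^ (s - 1)) 0 :=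
    ((hasDerivAt_id (0 : ℝ)).const_sub 1).rpow_const (by simp)
  have h1 : (fun u : ℝ ↦ 1 - (1 - u) ^ s) =O[𝓝 0] fun u ↦ u := by
    have := h.isBigO_sub.neg_left
    simpa using this
  have h2 : (fun t : ℝ ↦ 1 - (1 - 1 / t) ^ s) =O[atTop] fun t ↦ 1 / t :=
    h1.comp_tendsto (tendsto_const_nhds.div_atTop tendsto_id)
  refine ((isBigO_refl (fun t : ℝ ↦ t ^ e) atTop).mul h2).congr' .rfl ?_
  filter_upwards [eventually_gt_atTop 0] with t ht
  rw [rpow_sub_one ht.ne']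
  ring

/-- The density that is left after subtracting from `t ^ (q - p - 1)` its image under the
parallel sum `(s, t) ↦ s t / (s + t)` of Gaussian parameters. -/
noncomputable def parallelKernel (p q r t : ℝ) : ℝ :=
  t ^ (q - p - 1) - if r < t then t ^ (-p) * (t - r) ^ (q - 1) else 0

@[fun_prop]
theorem measurable_parallelKernel (p q : ℝ) :
    Measurable fun z : ℝ × ℝ ↦ parallelKernel p q z.1 z.2 := by
  unfold parallelKernel
  refine Measurable.sub (by fun_prop) (Measurable.ite ?_ (by fun_prop) (by fun_prop))
  exact measurableSet_lt measurable_fst measurable_snd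

theorem parallelKernel_mul (p q : ℝ) {r t : ℝ} (hr : 0 < r) (ht : 0 < t) :
    parallelKernel p q r (r * t) = r ^ (q - p - 1) * parallelKernel p q 1 t := by
  unfold parallelKernel
  have h : r < r * t ↔ 1 < t := by constructor <;> intro h <;> nlinarith
  simp only [h]
  split_ifs with h1
  · have e : r ^ (q - p - 1) = r ^ (-p) * r ^ (q - 1) := by
      rw [← rpow_add hr]; ring_nf
    rw [mul_rpow hr.le ht.le, mul_rpow hr.le ht.le, show r * t - r = r * (t - 1) by ring,
      mul_rpow hr.le (by linarith), e]
    ring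
  · rw [mul_rpow hr.le ht.le]
    ring

theorem parallelKernel_one_eq (p q : ℝ) {t : ℝ} (ht : 1 < t) :
    parallelKernel p q 1 t = t ^ (q - p - 1) * (1 - (1 - 1 / t) ^ (q - 1)) := by
  have ht0 : 0 < t := by linarith
  have e : 1 - 1 / t = (t - 1) / t := by field_simp
  rw [parallelKernel, if_pos ht, e, div_rpow (by linarith) ht0.le, mul_sub, mul_one,
    show q - p - 1 = -p + (q - 1) by ring, rpow_add ht0]
  field_simp

open Filter in
theorem integrableOn_Ioi_one_parallelKernel {p q : ℝ} (hpq : p < q) (hp : 0 < p)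
    (hqp : q < p + 1) : IntegrableOn (parallelKernel p q 1) (Set.Ioi 1) := by
  rw [← Set.Ioc_union_Ioi_eq_Ioi (one_le_two : (1 : ℝ) ≤ 2)]
  refine IntegrableOn.union ?_ ?_
  · have h1 : IntervalIntegrable (fun t : ℝ ↦ (t - 1) ^ (q - 1)) volume 1 2 := by
      have := (intervalIntegral.intervalIntegrable_rpow' (a := 0) (b := 1) (r := q - 1)
        (by linarith)).comp_sub_right 1
      norm_num at this
      exact this
    have hc (e : ℝ) : ContinuousOn (fun t : ℝ ↦ t ^ e) (Set.uIcc 1 2) := by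
      intro t ht
      rw [Set.uIcc_of_le one_le_two] at ht
      exact (continuousAt_rpow_const _ _ (.inl (by linarith [ht.1]))).continuousWithinAt
    have h2 := ((hc (q - p - 1)).intervalIntegrable (μ := volume)).sub
      (h1.continuousOn_mul (hc (-p)))
    refine ((intervalIntegrable_iff_integrableOn_Ioc_of_le one_le_two).1 h2).congr_fun ?_
      measurableSet_Ioc
    intro t ht
    simp [parallelKernel, ht.1]
  · refine IntegrableOn.mono_set ?_ Set.Ioi_subset_Ici_self
    refine LocallyIntegrableOn.integrableOn_of_isBigO_atTop (g := fun t ↦ t ^ (q - p - 1 - 1))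
      ?_ ?_ ?_
    · refine ContinuousOn.locallyIntegrableOn ?_ measurableSet_Ici
      have : ContinuousOn (fun t : ℝ ↦ t ^ (q - p - 1) * (1 - (1 - 1 / t) ^ (q - 1)))
          (Set.Ici 2) := by
        intro t ht
        have ht' : (2 : ℝ) ≤ t := ht
        have h0 : t ≠ 0 := by linarith
        have h1 : 1 - 1 / t ≠ 0 := by
          rw [one_sub_div h0]; exact div_ne_zero (by linarith) h0
        have h2 : ContinuousAt (fun t : ℝ ↦ 1 - 1 / t) t := by fun_prop (disch := assumption)
        exact ((continuousAt_rpow_const _ _ (.inl h0)).mul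
          (continuousAt_const.sub (h2.rpow_const (.inl h1)))).continuousWithinAt
      refine this.congr fun t ht ↦ parallelKernel_one_eq p q ?_
      have ht' : (2 : ℝ) ≤ t := ht
      linarith
    · refine (isBigO_rpow_mul_one_sub_rpow (q - p - 1) (q - 1)).congr' ?_ .rfl
      filter_upwards [eventually_gt_atTop 1] with t ht
      rw [parallelKernel_one_eq p q ht]
    · exact ⟨Set.Ioi 1, Ioi_mem_atTop 1, integrableOn_Ioi_rpow_of_lt (by linarith) one_pos⟩

theorem integrableOn_parallelKernel_one {p q : ℝ} (hpq : p < q) (hp : 0 < p)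
    (hqp : q < p + 1) : IntegrableOn (parallelKernel p q 1) (Set.Ioi 0) := by
  rw [← Set.Ioc_union_Ioi_eq_Ioi (zero_le_one : (0 : ℝ) ≤ 1)]
  refine IntegrableOn.union ?_ (integrableOn_Ioi_one_parallelKernel hpq hp hqp)
  refine IntegrableOn.congr_fun ((intervalIntegrable_iff_integrableOn_Ioc_of_le zero_le_one).1
    (intervalIntegral.intervalIntegrable_rpow' (r := q - p - 1) (by linarith))) ?_
    measurableSet_Ioc
  intro t ht
  simp [parallelKernel, ht.2.not_gt]

open Filter Topology in
theorem integral_parallelKernel_one {p q : ℝ} (hpq : p < q) (hp : 0 < p) (hqp : q < p + 1) :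
    ∫ t in Set.Ioi (0 : ℝ), parallelKernel p q 1 t =
      Real.Gamma q * Real.Gamma (1 + p - q) / ((q - p) * Real.Gamma p) := by
  have hq : 0 < q := by linarith
  have hΓ := Real.Gamma_pos_of_pos hp
  have hΓ' := Real.Gamma_pos_of_pos (by linarith : 0 < p + 1)
  have hΓq := Real.Gamma_pos_of_pos hq
  have hΓd := Real.Gamma_pos_of_pos (by linarith : 0 < 1 + p - q)
  have hker := integrableOn_Ioi_one_parallelKernel hpq hp hqp
  have hbeta := lintegral_Ioi_one_rpow_mul_sub_one_rpow hp hq hqp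
  have hnn : 0 ≤ᵐ[volume.restrict (Set.Ioi (1 : ℝ))]
      fun t ↦ t ^ (-p - 1) * (t - 1) ^ (q - 1) := by
    filter_upwards [self_mem_ae_restrict measurableSet_Ioi] with t ht
    have : 1 < t := ht
    exact mul_nonneg (rpow_nonneg (by linarith) _) (rpow_nonneg (by linarith) _)
  have hbint : IntegrableOn (fun t : ℝ ↦ t ^ (-p - 1) * (t - 1) ^ (q - 1)) (Set.Ioi 1) := by
    refine (lintegral_ofReal_ne_top_iff_integrable (by fun_prop) hnn).1 ?_
    rw [hbeta]; exact ENNReal.ofReal_ne_top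
  have hbval : ∫ t in Set.Ioi (1 : ℝ), t ^ (-p - 1) * (t - 1) ^ (q - 1) =
      Real.Gamma q * Real.Gamma (1 + p - q) / Real.Gamma (p + 1) := by
    rw [integral_eq_lintegral_of_nonneg_ae hnn (by fun_prop), hbeta,
      ENNReal.toReal_ofReal (by positivity)]
  have hcont : ContinuousWithinAt (fun t : ℝ ↦ t ^ (q - p) - t ^ (-p) * (t - 1) ^ q)
      (Set.Ici 1) 1 := by
    refine ContinuousAt.continuousWithinAt ?_
    refine (continuousAt_rpow_const _ _ (.inl one_ne_zero)).sub
      ((continuousAt_rpow_const _ _ (.inl one_ne_zero)).mul ?_)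
    exact ContinuousAt.rpow_const (by fun_prop) (.inr hq.le)
  have hder : ∀ t ∈ Set.Ioi (1 : ℝ),
      HasDerivAt (fun t : ℝ ↦ t ^ (q - p) - t ^ (-p) * (t - 1) ^ q)
        ((q - p) * parallelKernel p q 1 t - p * (t ^ (-p - 1) * (t - 1) ^ (q - 1))) t := by
    intro t ht
    have ht1 : (1 : ℝ) < t := ht
    have ht0 : 0 < t := by linarith
    have hs : 0 < t - 1 := by linarith
    have h1 : HasDerivAt (fun t : ℝ ↦ (t - 1) ^ q) (1 * q * (t - 1) ^ (q - 1)) t :=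
      ((hasDerivAt_id t).sub_const 1).rpow_const (.inl hs.ne')
    refine ((hasDerivAt_rpow_const (.inl ht0.ne')).sub
      ((hasDerivAt_rpow_const (.inl ht0.ne')).mul h1)).congr_deriv ?_
    rw [parallelKernel, if_pos ht1, rpow_sub_one ht0.ne' (-p), rpow_sub_one hs.ne' q]
    field_simp
    ring
  have hlim : Tendsto (fun t : ℝ ↦ t ^ (q - p) - t ^ (-p) * (t - 1) ^ q) atTop (𝓝 0) := by
    have h := (isBigO_rpow_mul_one_sub_rpow (q - p) q).trans_tendsto (by
      have := tendsto_rpow_neg_atTop (y := 1 + p - q) (by linarith)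
      convert this using 3
      ring)
    refine h.congr' ?_
    filter_upwards [eventually_gt_atTop 1] with t ht
    have ht0 : 0 < t := by linarith
    have e : 1 - 1 / t = (t - 1) / t := by field_simp
    rw [e, div_rpow (by linarith) ht0.le, mul_sub, mul_one,
      show q - p = -p + q by ring, rpow_add ht0]
    field_simp
  have hftc := integral_Ioi_of_hasDerivAt_of_tendsto hcont hder
    ((hker.const_mul _).sub (hbint.const_mul _)) hlim
  rw [integral_sub (hker.const_mul _) (hbint.const_mul _), integral_const_mul, integral_const_mul,
    hbval] at hftc
  have h01 : ∫ t in Set.Ioc (0 : ℝ) 1, parallelKernel p q 1 t = 1 / (q - p) := by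
    rw [setIntegral_congr_fun (g := fun t ↦ t ^ (q - p - 1)) measurableSet_Ioc
      (fun t ht ↦ by simp [parallelKernel, ht.2.not_gt]),
      ← intervalIntegral.integral_of_le zero_le_one, integral_rpow (.inl (by linarith)),
      sub_add_cancel, one_rpow, zero_rpow (by linarith), sub_zero]
  have hfull := integrableOn_parallelKernel_one hpq hp hqp
  rw [← Set.Ioc_union_Ioi_eq_Ioi (zero_le_one : (0 : ℝ) ≤ 1),
    setIntegral_union Set.Ioc_disjoint_Ioi_same measurableSet_Ioi
      (hfull.mono_set Set.Ioc_subset_Ioi_self) hker, h01]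
  have hd : q - p ≠ 0 := by linarith
  rw [Real.Gamma_add_one hp.ne'] at hftc
  simp only [one_rpow, sub_self, zero_rpow hq.ne', mul_zero, sub_zero, zero_sub] at hftc
  have e : p * (Real.Gamma q * Real.Gamma (1 + p - q) / (p * Real.Gamma p)) =
      Real.Gamma q * Real.Gamma (1 + p - q) / Real.Gamma p := by field_simp
  rw [e] at hftc
  have h3 : ∫ t in Set.Ioi (1 : ℝ), parallelKernel p q 1 t =
      (Real.Gamma q * Real.Gamma (1 + p - q) / Real.Gamma p - 1) / (q - p) := by
    rw [eq_div_iff hd]; linarith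
  rw [h3]
  field_simp
  ring

theorem integrableOn_parallelKernel {p q r : ℝ} (hpq : p < q) (hp : 0 < p)
    (hqp : q < p + 1) (hr : 0 < r) : IntegrableOn (parallelKernel p q r) (Set.Ioi 0) := by
  have h := integrableOn_Ioi_comp_mul_left_iff (parallelKernel p q r) 0 hr
  rw [mul_zero] at h
  refine h.1 (IntegrableOn.congr_fun
    ((integrableOn_parallelKernel_one hpq hp hqp).const_mul (r ^ (q - p - 1)))
    (fun t ht ↦ (parallelKernel_mul p q hr ht).symm) measurableSet_Ioi)

theorem integral_parallelKernel (p q : ℝ) {r : ℝ} (hr : 0 < r) :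
    ∫ t in Set.Ioi (0 : ℝ), parallelKernel p q r t =
      r ^ (q - p) * ∫ t in Set.Ioi (0 : ℝ), parallelKernel p q 1 t := by
  have h := integral_comp_mul_left_Ioi' (parallelKernel p q r) 0 hr
  rw [mul_zero] at h
  rw [← h, setIntegral_congr_fun measurableSet_Ioi
    (fun t ht ↦ parallelKernel_mul p q hr (Set.mem_Ioi.1 ht)), integral_const_mul, smul_eq_mul,
    ← mul_assoc, rpow_sub_one hr.ne']
  field_simp

theorem integral_abs_parallelKernel (p q : ℝ) {r : ℝ} (hr : 0 < r) :
    ∫ t in Set.Ioi (0 : ℝ), |parallelKernel p q r t| =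
      r ^ (q - p) * ∫ t in Set.Ioi (0 : ℝ), |parallelKernel p q 1 t| := by
  have h := integral_comp_mul_left_Ioi' (fun t ↦ |parallelKernel p q r t|) 0 hr
  rw [mul_zero] at h
  have e : ∀ t ∈ Set.Ioi (0 : ℝ), |parallelKernel p q r (r * t)| =
      r ^ (q - p - 1) * |parallelKernel p q 1 t| := fun t ht ↦ by
    rw [parallelKernel_mul p q hr (Set.mem_Ioi.1 ht), abs_mul, abs_of_pos (rpow_pos_of_pos hr _)]
  rw [← h, setIntegral_congr_fun measurableSet_Ioi e, integral_const_mul, smul_eq_mul,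
    ← mul_assoc, rpow_sub_one hr.ne']
  field_simp

theorem integrable_mul_parallelKernel {p q : ℝ} (hpq : p < q) (hp : 0 < p) (hqp : q < p + 1)
    {h : ℝ → ℝ} (hm : Measurable h)
    (hint : IntegrableOn (fun r ↦ h r * r ^ (q - p)) (Set.Ioi 0)) :
    Integrable (fun z : ℝ × ℝ ↦ h z.1 * parallelKernel p q z.1 z.2)
      ((volume.restrict (Set.Ioi 0)).prod (volume.restrict (Set.Ioi 0))) := by
  have hmeas : Measurable fun z : ℝ × ℝ ↦ h z.1 * parallelKernel p q z.1 z.2 := by fun_prop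
  refine (integrable_prod_iff hmeas.aestronglyMeasurable).2 ⟨?_, ?_⟩
  · filter_upwards [self_mem_ae_restrict measurableSet_Ioi] with r hr
    exact (integrableOn_parallelKernel hpq hp hqp hr).const_mul (h r)
  · refine (hint.norm.mul_const (∫ t in Set.Ioi (0 : ℝ), |parallelKernel p q 1 t|)).congr ?_
    filter_upwards [self_mem_ae_restrict measurableSet_Ioi] with r hr
    have hr' : 0 < r := hr
    simp_rw [norm_mul, norm_eq_abs]
    rw [integral_const_mul, integral_abs_parallelKernel p q hr', abs_of_pos (rpow_pos_of_pos hr' _),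
      mul_assoc]

theorem integral_integral_mul_parallelKernel {p q : ℝ} (hpq : p < q) (hp : 0 < p)
    (hqp : q < p + 1) {h : ℝ → ℝ} (hm : Measurable h)
    (hint : IntegrableOn (fun r ↦ h r * r ^ (q - p)) (Set.Ioi 0)) :
    ∫ t in Set.Ioi (0 : ℝ), ∫ r in Set.Ioi (0 : ℝ), h r * parallelKernel p q r t =
      (∫ r in Set.Ioi (0 : ℝ), h r * r ^ (q - p)) *
        ∫ t in Set.Ioi (0 : ℝ), parallelKernel p q 1 t := by
  rw [← integral_integral_swap (integrable_mul_parallelKernel hpq hp hqp hm hint),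
    ← integral_mul_const]
  refine setIntegral_congr_fun measurableSet_Ioi fun r hr ↦ ?_
  rw [integral_const_mul, integral_parallelKernel p q hr, mul_assoc]

theorem lintegral_mul_rpow_mul_exp_neg {n : ℕ} {q w : ℝ} (hq : 0 < q) (hw : 0 ≤ w)
    {x y : EuclideanSpace ℝ (Fin n)} (hxy : x = y → w = 0) :
    ∫⁻ t in Set.Ioi (0 : ℝ),
        ENNReal.ofReal (w * (t ^ (2 * q - 1) * exp (-(t * ‖x - y‖ ^ 2)))) =
      ENNReal.ofReal (Real.Gamma (2 * q)) * ENNReal.ofReal (w / ‖x - y‖ ^ (4 * q)) := by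
  by_cases h : x = y
  · simp [hxy h]
  have hpos : 0 < ‖x - y‖ := norm_pos_iff.2 (sub_ne_zero.2 h)
  have hΓ := Real.Gamma_pos_of_pos (by linarith : 0 < 2 * q)
  simp_rw [ENNReal.ofReal_mul hw, mul_comm _ (‖x - y‖ ^ 2)]
  rw [lintegral_const_mul' _ _ ENNReal.ofReal_ne_top,
    lintegral_rpow_mul_exp_neg_mul (by linarith) (by positivity), ← ENNReal.ofReal_mul hw,
    ← ENNReal.ofReal_mul hΓ.le]
  have e : (1 / ‖x - y‖ ^ 2) ^ (2 * q) = 1 / ‖x - y‖ ^ (4 * q) := by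
    rw [one_div, inv_rpow (by positivity), ← rpow_natCast, ← rpow_mul hpos.le, one_div]
    congr 2
    push_cast
    ring
  rw [e]
  ring_nf

/-- The mixture weight of the Gaussian with parameter `r` in the representation of
`‖x‖ ^ (-2 p)` integrated against `‖f x‖ ^ 2 ‖x‖ ^ (2 p)`. -/
noncomputable def gaussianWeight {n : ℕ} (p : ℝ) (f : EuclideanSpace ℝ (Fin n) → ℂ) (r : ℝ) :
    ENNReal :=
  ∫⁻ x, ENNReal.ofReal
    (‖f x‖ ^ 2 * ‖x‖ ^ (2 * p) / Real.Gamma p * (r ^ (p - 1) * exp (-(‖x‖ ^ 2 * r))))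

theorem measurable_gaussianWeight {n : ℕ} (p : ℝ) {f : EuclideanSpace ℝ (Fin n) → ℂ}
    (hf : Measurable f) : Measurable (gaussianWeight p f) := by
  unfold gaussianWeight
  exact Measurable.lintegral_prod_right' (f := fun z : ℝ × EuclideanSpace ℝ (Fin n) ↦
    ENNReal.ofReal (‖f z.2‖ ^ 2 * ‖z.2‖ ^ (2 * p) / Real.Gamma p *
      (z.1 ^ (p - 1) * exp (-(‖z.2‖ ^ 2 * z.1))))) (by fun_prop)

theorem ae_ne_zero {n : ℕ} (hn : 0 < n) :
    ∀ᵐ x : EuclideanSpace ℝ (Fin n), x ≠ 0 := by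
  have : Nonempty (Fin n) := ⟨⟨0, hn⟩⟩
  exact Measure.ae_ne volume 0

theorem lintegral_gaussianWeight_mul_rpow {n : ℕ} (hn : 0 < n) {p e : ℝ} (hp : 0 < p)
    (he : 0 < p + e) {f : EuclideanSpace ℝ (Fin n) → ℂ} (hf : Measurable f) :
    ∫⁻ r in Set.Ioi (0 : ℝ), gaussianWeight p f r * ENNReal.ofReal (r ^ e) =
      ENNReal.ofReal (Real.Gamma (p + e) / Real.Gamma p) *
        ∫⁻ x, ENNReal.ofReal (‖x‖ ^ (-(2 * e)) * ‖f x‖ ^ 2) := by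
  have hΓ := Real.Gamma_pos_of_pos hp
  have hΓe := Real.Gamma_pos_of_pos he
  simp_rw [gaussianWeight, ← lintegral_mul_const' _ _ ENNReal.ofReal_ne_top]
  rw [lintegral_lintegral_swap (by fun_prop), ← lintegral_const_mul' _ _ ENNReal.ofReal_ne_top]
  refine lintegral_congr_ae ?_
  filter_upwards [ae_ne_zero hn] with x hx
  have hx' : 0 < ‖x‖ := norm_pos_iff.2 hx
  have h1 : ∀ r ∈ Set.Ioi (0 : ℝ), ENNReal.ofReal (‖f x‖ ^ 2 * ‖x‖ ^ (2 * p) / Real.Gamma p *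
        (r ^ (p - 1) * exp (-(‖x‖ ^ 2 * r)))) * ENNReal.ofReal (r ^ e) =
      ENNReal.ofReal (‖f x‖ ^ 2 * ‖x‖ ^ (2 * p) / Real.Gamma p) *
        ENNReal.ofReal (r ^ ((p + e) - 1) * exp (-(‖x‖ ^ 2 * r))) := by
    intro r hr
    have hr' : 0 < r := hr
    rw [← ENNReal.ofReal_mul (by positivity), ← ENNReal.ofReal_mul (by positivity),
      show p + e - 1 = (p - 1) + e by ring, rpow_add hr']
    ring_nf
  rw [setLIntegral_congr_fun measurableSet_Ioi h1,
    lintegral_const_mul' _ _ ENNReal.ofReal_ne_top,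
    lintegral_rpow_mul_exp_neg_mul he (by positivity), ← ENNReal.ofReal_mul (by positivity),
    ← ENNReal.ofReal_mul (by positivity)]
  have h2 : (1 / ‖x‖ ^ 2) ^ (p + e) = ‖x‖ ^ (-(2 * e)) / ‖x‖ ^ (2 * p) := by
    rw [one_div, inv_rpow (by positivity), ← rpow_natCast, ← rpow_mul hx'.le,
      ← rpow_neg hx'.le, ← rpow_sub hx']
    congr 1
    push_cast
    ring
  rw [h2]
  congr 1
  field_simp

theorem lintegral_sq_norm_mul_exp_neg {n : ℕ} {p q t : ℝ} (hpq : p + q = n / 2) (ht : 0 < t)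
    (f : EuclideanSpace ℝ (Fin n) → ℂ) :
    ∫⁻ x, ∫⁻ y, ENNReal.ofReal
        (‖f x‖ ^ 2 * (t ^ (2 * q - 1) * exp (-(t * ‖x - y‖ ^ 2)))) =
      ENNReal.ofReal (π ^ (p + q) * t ^ (q - p - 1)) * ∫⁻ x, ENNReal.ofReal (‖f x‖ ^ 2) := by
  rw [← lintegral_const_mul' _ _ ENNReal.ofReal_ne_top]
  refine lintegral_congr fun x ↦ ?_
  have h := lintegral_exp_neg_mul_sq_norm_mul ht le_rfl x
  simp only [zero_mul, neg_zero, exp_zero, mul_one, mul_zero, zero_div, add_zero] at h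
  simp_rw [← mul_assoc, ENNReal.ofReal_mul
    (by positivity : 0 ≤ ‖f x‖ ^ 2 * t ^ (2 * q - 1))]
  rw [lintegral_const_mul' _ _ ENNReal.ofReal_ne_top,
    lintegral_sub_left_eq_self (fun y ↦ ENNReal.ofReal (exp (-(t * ‖y‖ ^ 2)))), h,
    ← ENNReal.ofReal_mul (by positivity), ← ENNReal.ofReal_mul (by positivity), ← hpq,
    div_rpow pi_nonneg ht.le, show q - p - 1 = (2 * q - 1) - (p + q) by ring,
    rpow_sub ht (2 * q - 1)]
  ring_nf

theorem lintegral_rpow_norm_mul_exp_neg {n : ℕ} (hn : 0 < n) {p q t : ℝ} (hp : 0 < p)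
    (hpq : p + q = n / 2) (ht : 0 < t) (x : EuclideanSpace ℝ (Fin n)) :
    ∫⁻ y, ENNReal.ofReal (‖y‖ ^ (-(2 * p)) * (t ^ (2 * q - 1) * exp (-(t * ‖x - y‖ ^ 2)))) =
      ENNReal.ofReal (π ^ (p + q)) * ∫⁻ r in Set.Ioo 0 t,
        ENNReal.ofReal (1 / Real.Gamma p * (r ^ (p - 1) * exp (-(‖x‖ ^ 2 * r)))) *
          ENNReal.ofReal (t ^ (-p) * (t - r) ^ (q - 1)) := by
  have hΓ := Real.Gamma_pos_of_pos hp
  have h1 : ∀ᵐ y : EuclideanSpace ℝ (Fin n), ENNReal.ofReal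
        (‖y‖ ^ (-(2 * p)) * (t ^ (2 * q - 1) * exp (-(t * ‖x - y‖ ^ 2)))) =
      ∫⁻ s in Set.Ioi (0 : ℝ), ENNReal.ofReal (1 / Real.Gamma p * t ^ (2 * q - 1)) *
        (ENNReal.ofReal (s ^ (p - 1)) *
          ENNReal.ofReal (exp (-(s * ‖y‖ ^ 2)) * exp (-(t * ‖x - y‖ ^ 2)))) := by
    filter_upwards [ae_ne_zero hn] with y hy
    have hy' : 0 < ‖y‖ := norm_pos_iff.2 hy
    have h := lintegral_rpow_mul_exp_neg_mul hp (by positivity : 0 < ‖y‖ ^ 2)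
    have e : (1 / ‖y‖ ^ 2) ^ p = ‖y‖ ^ (-(2 * p)) := by
      rw [one_div, inv_rpow (by positivity), ← rpow_natCast, ← rpow_mul hy'.le,
        ← rpow_neg hy'.le]
      norm_num
    rw [e] at h
    have e2 : ‖y‖ ^ (-(2 * p)) * (t ^ (2 * q - 1) * exp (-(t * ‖x - y‖ ^ 2))) =
        (1 / Real.Gamma p * t ^ (2 * q - 1) * exp (-(t * ‖x - y‖ ^ 2))) *
          (‖y‖ ^ (-(2 * p)) * Real.Gamma p) := by
      field_simp
    rw [e2, ENNReal.ofReal_mul (by positivity), ← h,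
      ← lintegral_const_mul' _ _ ENNReal.ofReal_ne_top]
    refine setLIntegral_congr_fun measurableSet_Ioi fun s hs ↦ ?_
    have hs' : 0 < s := hs
    rw [← ENNReal.ofReal_mul (by positivity), ← ENNReal.ofReal_mul (by positivity),
      ← ENNReal.ofReal_mul (by positivity)]
    ring_nf
  have h2 : ∀ s ∈ Set.Ioi (0 : ℝ), (∫⁻ y : EuclideanSpace ℝ (Fin n),
      ENNReal.ofReal (1 / Real.Gamma p * t ^ (2 * q - 1)) * (ENNReal.ofReal (s ^ (p - 1)) *
          ENNReal.ofReal (exp (-(s * ‖y‖ ^ 2)) * exp (-(t * ‖x - y‖ ^ 2))))) =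
      ENNReal.ofReal (1 / Real.Gamma p * t ^ (2 * q - 1)) * ENNReal.ofReal
        (s ^ (p - 1) * ((π / (s + t)) ^ (p + q) * exp (-(s * t / (s + t) * ‖x‖ ^ 2)))) := by
    intro s hs
    have hs' : 0 < s := hs
    rw [lintegral_const_mul' _ _ ENNReal.ofReal_ne_top,
      lintegral_const_mul' _ _ ENNReal.ofReal_ne_top,
      lintegral_exp_neg_mul_sq_norm_mul hs' ht.le, hpq, ← ENNReal.ofReal_mul (by positivity)]
  rw [lintegral_congr_ae h1, lintegral_lintegral_swap (by fun_prop),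
    setLIntegral_congr_fun measurableSet_Ioi h2, lintegral_const_mul' _ _ ENNReal.ofReal_ne_top,
    lintegral_rpow_mul_exp_neg_parallel ht, ← lintegral_const_mul' _ _ ENNReal.ofReal_ne_top,
    ← lintegral_const_mul' _ _ ENNReal.ofReal_ne_top]
  refine setLIntegral_congr_fun measurableSet_Ioo fun r hr ↦ ?_
  have hr0 : 0 < r := hr.1
  have hr1 : 0 < t - r := by linarith [hr.2]
  rw [← ENNReal.ofReal_mul (by positivity), ← ENNReal.ofReal_mul (by positivity),
    ← ENNReal.ofReal_mul (by positivity)]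
  have e : t ^ (-p) = t ^ (2 * q - 1) * t ^ (1 - p - 2 * q) := by
    rw [← rpow_add ht]; ring_nf
  rw [e]
  ring_nf

theorem lintegral_sq_norm_mul_rpow_norm_mul_exp_neg {n : ℕ} (hn : 0 < n) {p q t : ℝ}
    (hp : 0 < p) (hpq : p + q = n / 2) (ht : 0 < t) {f : EuclideanSpace ℝ (Fin n) → ℂ}
    (hf : Measurable f) :
    ∫⁻ x, ∫⁻ y, ENNReal.ofReal (‖f x‖ ^ 2 * ‖x‖ ^ (2 * p) * ‖y‖ ^ (-(2 * p)) *
        (t ^ (2 * q - 1) * exp (-(t * ‖x - y‖ ^ 2)))) =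
      ENNReal.ofReal (π ^ (p + q)) * ∫⁻ r in Set.Ioo 0 t,
        gaussianWeight p f r * ENNReal.ofReal (t ^ (-p) * (t - r) ^ (q - 1)) := by
  have h (x : EuclideanSpace ℝ (Fin n)) :
      ∫⁻ y, ENNReal.ofReal (‖f x‖ ^ 2 * ‖x‖ ^ (2 * p) * ‖y‖ ^ (-(2 * p)) *
        (t ^ (2 * q - 1) * exp (-(t * ‖x - y‖ ^ 2)))) =
      ENNReal.ofReal (π ^ (p + q)) * ∫⁻ r in Set.Ioo 0 t, ENNReal.ofReal
        (‖f x‖ ^ 2 * ‖x‖ ^ (2 * p) / Real.Gamma p * (r ^ (p - 1) * exp (-(‖x‖ ^ 2 * r)))) *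
          ENNReal.ofReal (t ^ (-p) * (t - r) ^ (q - 1)) := by
    have hc : 0 ≤ ‖f x‖ ^ 2 * ‖x‖ ^ (2 * p) := by positivity
    simp_rw [mul_assoc (‖f x‖ ^ 2 * ‖x‖ ^ (2 * p)), ENNReal.ofReal_mul hc]
    rw [lintegral_const_mul' _ _ ENNReal.ofReal_ne_top,
      lintegral_rpow_norm_mul_exp_neg hn hp hpq ht, mul_left_comm,
      ← lintegral_const_mul' _ _ ENNReal.ofReal_ne_top]
    congr 1
    refine lintegral_congr fun r ↦ ?_
    rw [← mul_assoc, ← ENNReal.ofReal_mul hc]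
    ring_nf
  simp_rw [h]
  rw [lintegral_const_mul' _ _ ENNReal.ofReal_ne_top, lintegral_lintegral_swap (by fun_prop)]
  simp_rw [lintegral_mul_const' _ _ ENNReal.ofReal_ne_top]
  rfl

theorem norm_sub_sq_add_eq {F : Type*} [NormedAddCommGroup F] [InnerProductSpace ℝ F] {X Y : ℝ}
    (hX : 0 < X) (hY : 0 < Y) (p : ℝ) (u v : F) :
    ‖u - v‖ ^ 2 + (‖u‖ ^ 2 * X ^ (2 * p) * Y ^ (-(2 * p)) +
        ‖v‖ ^ 2 * Y ^ (2 * p) * X ^ (-(2 * p))) =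
      X ^ (-(2 * p)) * Y ^ (-(2 * p)) * ‖X ^ (2 * p) • u - Y ^ (2 * p) • v‖ ^ 2 +
        (‖u‖ ^ 2 + ‖v‖ ^ 2) := by
  rw [norm_sub_sq_real, norm_sub_sq_real, norm_smul, norm_smul, inner_smul_left,
    inner_smul_right, norm_of_nonneg (by positivity), norm_of_nonneg (by positivity),
    rpow_neg hX.le, rpow_neg hY.le]
  simp only [conj_trivial]
  have := rpow_pos_of_pos hX (2 * p)
  have := rpow_pos_of_pos hY (2 * p)
  field_simp
  ring

theorem lintegral_prod_add_swap {α : Type*} [MeasurableSpace α] {μ : Measure α} [SFinite μ]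
    {g : α × α → ENNReal} (hg : Measurable g) :
    ∫⁻ z, (g z + g z.swap) ∂(μ.prod μ) = 2 * ∫⁻ x, ∫⁻ y, g (x, y) ∂μ ∂μ := by
  rw [lintegral_add_left hg, lintegral_prod_swap, lintegral_prod _ hg.aemeasurable, two_mul]

theorem lintegral_ground_state_gaussian {n : ℕ} (hn : 0 < n) {p q t : ℝ} (hp : 0 < p)
    (hpq : p + q = n / 2) (ht : 0 < t) {f : EuclideanSpace ℝ (Fin n) → ℂ} (hf : Measurable f) :
    (∫⁻ z : EuclideanSpace ℝ (Fin n) × EuclideanSpace ℝ (Fin n), ENNReal.ofReal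
        (‖f z.1 - f z.2‖ ^ 2 * (t ^ (2 * q - 1) * exp (-(t * ‖z.1 - z.2‖ ^ 2))))) +
      2 * (ENNReal.ofReal (π ^ (p + q)) * ∫⁻ r in Set.Ioo 0 t,
        gaussianWeight p f r * ENNReal.ofReal (t ^ (-p) * (t - r) ^ (q - 1))) =
    (∫⁻ z : EuclideanSpace ℝ (Fin n) × EuclideanSpace ℝ (Fin n), ENNReal.ofReal
        (‖z.1‖ ^ (-(2 * p)) * ‖z.2‖ ^ (-(2 * p)) *
          ‖(‖z.1‖ ^ (2 * p) : ℝ) • f z.1 - (‖z.2‖ ^ (2 * p) : ℝ) • f z.2‖ ^ 2 *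
          (t ^ (2 * q - 1) * exp (-(t * ‖z.1 - z.2‖ ^ 2))))) +
      2 * (ENNReal.ofReal (π ^ (p + q) * t ^ (q - p - 1)) *
        ∫⁻ x, ENNReal.ofReal (‖f x‖ ^ 2)) := by
  rw [← lintegral_sq_norm_mul_rpow_norm_mul_exp_neg hn hp hpq ht hf,
    ← lintegral_sq_norm_mul_exp_neg hpq ht f]
  have hB := lintegral_prod_add_swap (μ := (volume : Measure (EuclideanSpace ℝ (Fin n))))
    (g := fun z ↦ ENNReal.ofReal (‖f z.1‖ ^ 2 * ‖z.1‖ ^ (2 * p) * ‖z.2‖ ^ (-(2 * p)) *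
      (t ^ (2 * q - 1) * exp (-(t * ‖z.1 - z.2‖ ^ 2))))) (by fun_prop)
  have hA := lintegral_prod_add_swap (μ := (volume : Measure (EuclideanSpace ℝ (Fin n))))
    (g := fun z ↦ ENNReal.ofReal (‖f z.1‖ ^ 2 *
      (t ^ (2 * q - 1) * exp (-(t * ‖z.1 - z.2‖ ^ 2))))) (by fun_prop)
  rw [← hB, ← hA, Measure.volume_eq_prod, ← lintegral_add_left (by fun_prop),
    ← lintegral_add_left (by fun_prop)]
  refine lintegral_congr_ae ?_
  have h1 := Measure.quasiMeasurePreserving_fst (μ := (volume : Measure (EuclideanSpace ℝ (Fin n))))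
    (ν := (volume : Measure (EuclideanSpace ℝ (Fin n)))) |>.ae (ae_ne_zero hn)
  have h2 := Measure.quasiMeasurePreserving_snd (μ := (volume : Measure (EuclideanSpace ℝ (Fin n))))
    (ν := (volume : Measure (EuclideanSpace ℝ (Fin n)))) |>.ae (ae_ne_zero hn)
  filter_upwards [h1, h2] with z hz1 hz2
  have hX : 0 < ‖z.1‖ := norm_pos_iff.2 hz1
  have hY : 0 < ‖z.2‖ := norm_pos_iff.2 hz2
  simp only [Prod.fst_swap, Prod.snd_swap]
  rw [norm_sub_rev z.2 z.1, ← ENNReal.ofReal_add (by positivity) (by positivity),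
    ← ENNReal.ofReal_add (by positivity) (by positivity),
    ← ENNReal.ofReal_add (by positivity) (by positivity),
    ← ENNReal.ofReal_add (by positivity) (by positivity), ← add_mul, ← add_mul, ← add_mul,
    ← add_mul, norm_sub_sq_add_eq hX hY]

theorem lintegral_lintegral_mul_rpow_mul_exp_neg {n : ℕ} {q : ℝ} (hq : 0 < q)
    {w : EuclideanSpace ℝ (Fin n) × EuclideanSpace ℝ (Fin n) → ℝ} (hw : Measurable w)
    (hw0 : ∀ z, 0 ≤ w z) (hdiag : ∀ x, w (x, x) = 0) :
    ∫⁻ t in Set.Ioi (0 : ℝ), ∫⁻ z,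
        ENNReal.ofReal (w z * (t ^ (2 * q - 1) * exp (-(t * ‖z.1 - z.2‖ ^ 2)))) =
      ENNReal.ofReal (Real.Gamma (2 * q)) *
        ∫⁻ z, ENNReal.ofReal (w z / ‖z.1 - z.2‖ ^ (4 * q)) := by
  rw [lintegral_lintegral_swap (by fun_prop), ← lintegral_const_mul' _ _ ENNReal.ofReal_ne_top]
  refine lintegral_congr fun z ↦ lintegral_mul_rpow_mul_exp_neg hq (hw0 z) fun h ↦ ?_
  rw [← hdiag z.1]
  congr 1
  exact Prod.ext rfl h.symm

theorem lintegral_gaussianWeight {n : ℕ} (hn : 0 < n) {p : ℝ} (hp : 0 < p)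
    {f : EuclideanSpace ℝ (Fin n) → ℂ} (hf : Measurable f) :
    ∫⁻ r in Set.Ioi (0 : ℝ), gaussianWeight p f r = ∫⁻ x, ENNReal.ofReal (‖f x‖ ^ 2) := by
  have h := lintegral_gaussianWeight_mul_rpow (e := 0) hn hp (by linarith) hf
  simpa [div_self (Real.Gamma_pos_of_pos hp).ne'] using h

theorem setLIntegral_gaussianWeight_eq_sub {n : ℕ} (hn : 0 < n) {p q t : ℝ} (hp : 0 < p)
    (ht : 0 < t) {f : EuclideanSpace ℝ (Fin n) → ℂ} (hf : Measurable f)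
    (hL2 : ∫⁻ x, ENNReal.ofReal (‖f x‖ ^ 2) ≠ ⊤)
    (hint : IntegrableOn (fun r ↦ (gaussianWeight p f r).toReal * parallelKernel p q r t)
      (Set.Ioi 0)) :
    ∃ S : ℝ, 0 ≤ S ∧ (∫⁻ r in Set.Ioo 0 t,
        gaussianWeight p f r * ENNReal.ofReal (t ^ (-p) * (t - r) ^ (q - 1))) =
          ENNReal.ofReal S ∧
      ∫ r in Set.Ioi (0 : ℝ), (gaussianWeight p f r).toReal * parallelKernel p q r t =
        t ^ (q - p - 1) * (∫⁻ x, ENNReal.ofReal (‖f x‖ ^ 2)).toReal - S := by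
  have hm := measurable_gaussianWeight p hf
  have hmass := lintegral_gaussianWeight hn hp hf
  have hfin : ∀ᵐ r ∂volume.restrict (Set.Ioi (0 : ℝ)), gaussianWeight p f r < ⊤ :=
    ae_lt_top hm (by rwa [hmass])
  have hw : IntegrableOn (fun r ↦ (gaussianWeight p f r).toReal) (Set.Ioi 0) :=
    integrable_toReal_of_lintegral_ne_top hm.aemeasurable (by rwa [hmass])
  have hwint : ∫ r in Set.Ioi (0 : ℝ), (gaussianWeight p f r).toReal =
      (∫⁻ x, ENNReal.ofReal (‖f x‖ ^ 2)).toReal := by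
    rw [integral_toReal hm.aemeasurable hfin, hmass]
  have hdiff : IntegrableOn (fun r ↦ (gaussianWeight p f r).toReal * t ^ (q - p - 1) -
      (gaussianWeight p f r).toReal * parallelKernel p q r t) (Set.Ioi 0) :=
    (hw.mul_const (t ^ (q - p - 1))).sub hint
  have hind : ∀ r, (gaussianWeight p f r).toReal * t ^ (q - p - 1) -
      (gaussianWeight p f r).toReal * parallelKernel p q r t =
      (Set.Iio t).indicator
        (fun r ↦ (gaussianWeight p f r).toReal * (t ^ (-p) * (t - r) ^ (q - 1))) r := by
    intro r
    unfold parallelKernel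
    by_cases hr : r < t
    · simp [hr]
      ring
    · simp [hr]
  have hnn : ∀ r, 0 ≤ (gaussianWeight p f r).toReal * t ^ (q - p - 1) -
      (gaussianWeight p f r).toReal * parallelKernel p q r t := by
    intro r
    rw [hind]
    refine Set.indicator_nonneg (fun r hr ↦ ?_) r
    have : 0 < t - r := sub_pos.2 hr
    positivity
  refine ⟨∫ r in Set.Ioi (0 : ℝ), ((gaussianWeight p f r).toReal * t ^ (q - p - 1) -
      (gaussianWeight p f r).toReal * parallelKernel p q r t), integral_nonneg hnn, ?_, ?_⟩
  · rw [ofReal_integral_eq_lintegral_ofReal hdiff (.of_forall hnn), ← Set.Iio_inter_Ioi,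
      ← Measure.restrict_restrict measurableSet_Iio, ← lintegral_indicator measurableSet_Iio]
    refine lintegral_congr_ae ?_
    filter_upwards [hfin] with r hr
    rw [hind]
    by_cases hrt : r < t
    · simp only [Set.indicator, Set.mem_Iio, hrt, if_true]
      rw [ENNReal.ofReal_mul ENNReal.toReal_nonneg, ENNReal.ofReal_toReal hr.ne]
    · simp [hrt]
  · rw [integral_sub (hw.mul_const _) hint, integral_mul_const, hwint]
    ring

theorem ground_state_representation_of_finite {n : ℕ} (hn : 0 < n) {p q : ℝ} (hp : 0 < p)
    (hlt : p < q) (hqp : q < p + 1) (hpq : p + q = n / 2)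
    {f : EuclideanSpace ℝ (Fin n) → ℂ} (hf : Measurable f)
    (hI : ∫⁻ z : EuclideanSpace ℝ (Fin n) × EuclideanSpace ℝ (Fin n),
      ENNReal.ofReal (‖f z.1 - f z.2‖ ^ 2 / ‖z.1 - z.2‖ ^ (4 * q)) ≠ ⊤)
    (hL2 : ∫⁻ x, ENNReal.ofReal (‖f x‖ ^ 2) ≠ ⊤)
    (hH : ∫⁻ x, ENNReal.ofReal (‖x‖ ^ (-(2 * (q - p))) * ‖f x‖ ^ 2) ≠ ⊤) :
    (∫⁻ z : EuclideanSpace ℝ (Fin n) × EuclideanSpace ℝ (Fin n), ENNReal.ofReal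
        (‖z.1‖ ^ (-(2 * p)) * ‖z.2‖ ^ (-(2 * p)) *
          ‖(‖z.1‖ ^ (2 * p) : ℝ) • f z.1 - (‖z.2‖ ^ (2 * p) : ℝ) • f z.2‖ ^ 2 /
          ‖z.1 - z.2‖ ^ (4 * q))) ≠ ⊤ ∧
    Real.Gamma (2 * q) * (∫⁻ z : EuclideanSpace ℝ (Fin n) × EuclideanSpace ℝ (Fin n),
        ENNReal.ofReal (‖f z.1 - f z.2‖ ^ 2 / ‖z.1 - z.2‖ ^ (4 * q))).toReal =
      2 * π ^ (p + q) * (Real.Gamma q / Real.Gamma p *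
          (∫⁻ x, ENNReal.ofReal (‖x‖ ^ (-(2 * (q - p))) * ‖f x‖ ^ 2)).toReal *
          (Real.Gamma q * Real.Gamma (1 + p - q) / ((q - p) * Real.Gamma p))) +
      Real.Gamma (2 * q) * (∫⁻ z : EuclideanSpace ℝ (Fin n) × EuclideanSpace ℝ (Fin n),
        ENNReal.ofReal (‖z.1‖ ^ (-(2 * p)) * ‖z.2‖ ^ (-(2 * p)) *
          ‖(‖z.1‖ ^ (2 * p) : ℝ) • f z.1 - (‖z.2‖ ^ (2 * p) : ℝ) • f z.2‖ ^ 2 /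
          ‖z.1 - z.2‖ ^ (4 * q))).toReal := by
  have hq : 0 < q := hp.trans hlt
  have hΓp := Real.Gamma_pos_of_pos hp
  have hΓq := Real.Gamma_pos_of_pos hq
  have hΓ := Real.Gamma_pos_of_pos (by linarith : 0 < 2 * q)
  have hm := measurable_gaussianWeight p hf
  have hmass := lintegral_gaussianWeight hn hp hf
  have hfin : ∀ᵐ r ∂volume.restrict (Set.Ioi (0 : ℝ)), gaussianWeight p f r < ⊤ :=
    ae_lt_top hm (by rwa [hmass])
  have hmom := lintegral_gaussianWeight_mul_rpow (e := q - p) hn hp (by linarith) hf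
  rw [add_sub_cancel] at hmom
  have hmomm : Measurable fun r : ℝ ↦ gaussianWeight p f r * ENNReal.ofReal (r ^ (q - p)) := by
    fun_prop
  have hmomfin : ∫⁻ r in Set.Ioi (0 : ℝ), gaussianWeight p f r * ENNReal.ofReal (r ^ (q - p)) ≠ ⊤ :=
    by rw [hmom]; exact ENNReal.mul_ne_top ENNReal.ofReal_ne_top hH
  have hmomeq : ∀ r ∈ Set.Ioi (0 : ℝ),
      (gaussianWeight p f r * ENNReal.ofReal (r ^ (q - p))).toReal =
      (gaussianWeight p f r).toReal * r ^ (q - p) := fun r hr ↦ by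
    have : 0 < r := hr
    rw [ENNReal.toReal_mul, ENNReal.toReal_ofReal (by positivity)]
  have hint : IntegrableOn (fun r ↦ (gaussianWeight p f r).toReal * r ^ (q - p)) (Set.Ioi 0) :=
    IntegrableOn.congr_fun
      (integrable_toReal_of_lintegral_ne_top hmomm.aemeasurable hmomfin) hmomeq measurableSet_Ioi
  have hintval : ∫ r in Set.Ioi (0 : ℝ), (gaussianWeight p f r).toReal * r ^ (q - p) =
      Real.Gamma q / Real.Gamma p *
        (∫⁻ x, ENNReal.ofReal (‖x‖ ^ (-(2 * (q - p))) * ‖f x‖ ^ 2)).toReal := by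
    rw [← setIntegral_congr_fun measurableSet_Ioi hmomeq,
      integral_toReal hmomm.aemeasurable (ae_lt_top hmomm hmomfin), hmom, ENNReal.toReal_mul,
      ENNReal.toReal_ofReal (by positivity)]
  have hprod := integrable_mul_parallelKernel hlt hp hqp hm.ennreal_toReal hint
  have hF := integral_integral_mul_parallelKernel hlt hp hqp hm.ennreal_toReal hint
  rw [hintval, integral_parallelKernel_one hlt hp hqp] at hF
  rw [← hF]
  set P : EuclideanSpace ℝ (Fin n) × EuclideanSpace ℝ (Fin n) → ℝ :=
    fun z ↦ ‖f z.1 - f z.2‖ ^ 2 with hPdef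
  set Q : EuclideanSpace ℝ (Fin n) × EuclideanSpace ℝ (Fin n) → ℝ :=
    fun z ↦ ‖z.1‖ ^ (-(2 * p)) * ‖z.2‖ ^ (-(2 * p)) *
          ‖(‖z.1‖ ^ (2 * p) : ℝ) • f z.1 - (‖z.2‖ ^ (2 * p) : ℝ) • f z.2‖ ^ 2 with hQdef
  have hPm : Measurable P := by fun_prop
  have hQm : Measurable Q := by fun_prop
  have hIt := lintegral_lintegral_mul_rpow_mul_exp_neg hq hPm (fun z ↦ by positivity)
    (fun x ↦ by simp [P])
  have hJt := lintegral_lintegral_mul_rpow_mul_exp_neg hq hQm (fun z ↦ by positivity)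
    (fun x ↦ by simp [Q])
  set I : ℝ → ENNReal := fun t ↦ ∫⁻ z,
    ENNReal.ofReal (P z * (t ^ (2 * q - 1) * exp (-(t * ‖z.1 - z.2‖ ^ 2)))) with hIdef
  set J : ℝ → ENNReal := fun t ↦ ∫⁻ z,
    ENNReal.ofReal (Q z * (t ^ (2 * q - 1) * exp (-(t * ‖z.1 - z.2‖ ^ 2)))) with hJdef
  have hIm : Measurable I := Measurable.lintegral_prod_right'
    (f := fun u : ℝ × EuclideanSpace ℝ (Fin n) × EuclideanSpace ℝ (Fin n) ↦ ENNReal.ofReal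
      (P u.2 * (u.1 ^ (2 * q - 1) * exp (-(u.1 * ‖u.2.1 - u.2.2‖ ^ 2))))) (by fun_prop)
  have hJm : Measurable J := Measurable.lintegral_prod_right'
    (f := fun u : ℝ × EuclideanSpace ℝ (Fin n) × EuclideanSpace ℝ (Fin n) ↦ ENNReal.ofReal
      (Q u.2 * (u.1 ^ (2 * q - 1) * exp (-(u.1 * ‖u.2.1 - u.2.2‖ ^ 2))))) (by fun_prop)
  have hIfin : ∫⁻ t in Set.Ioi (0 : ℝ), I t ≠ ⊤ := by
    rw [hIt]; exact ENNReal.mul_ne_top ENNReal.ofReal_ne_top hI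
  have hIae := ae_lt_top hIm hIfin
  have hJ : ∀ᵐ t ∂volume.restrict (Set.Ioi (0 : ℝ)), J t < ⊤ ∧ (J t).toReal =
      (I t).toReal - 2 * π ^ (p + q) * ∫ r in Set.Ioi (0 : ℝ),
        (gaussianWeight p f r).toReal * parallelKernel p q r t := by
    filter_upwards [hIae, hprod.prod_left_ae, self_mem_ae_restrict measurableSet_Ioi]
      with t hItop hker ht
    have ht0 : 0 < t := ht
    obtain ⟨S, hS0, hS, hval⟩ := setLIntegral_gaussianWeight_eq_sub hn hp ht0 hf hL2 hker
    have hkey : I t + _ = J t + _ := lintegral_ground_state_gaussian hn hp hpq ht0 hf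
    rw [hS] at hkey
    have hJtop : J t < ⊤ := by
      refine lt_of_le_of_lt (le_self_add.trans_eq hkey.symm) ?_
      exact ENNReal.add_lt_top.2 ⟨hItop, ENNReal.mul_lt_top (by simp)
        (ENNReal.mul_lt_top ENNReal.ofReal_lt_top ENNReal.ofReal_lt_top)⟩
    refine ⟨hJtop, ?_⟩
    have := congrArg ENNReal.toReal hkey
    rw [ENNReal.toReal_add hItop.ne (by finiteness), ENNReal.toReal_add hJtop.ne (by finiteness)]
      at this
    simp only [ENNReal.toReal_mul, ENNReal.toReal_ofNat, ENNReal.toReal_ofReal hS0] at this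
    rw [ENNReal.toReal_ofReal (by positivity), ENNReal.toReal_ofReal (by positivity)] at this
    rw [hval]
    linarith
  have hIint : IntegrableOn (fun t ↦ (I t).toReal) (Set.Ioi 0) :=
    integrable_toReal_of_lintegral_ne_top hIm.aemeasurable hIfin
  have hFint := hprod.integral_prod_right
  have hJint : IntegrableOn (fun t ↦ (J t).toReal) (Set.Ioi 0) :=
    (hIint.sub (hFint.const_mul (2 * π ^ (p + q)))).congr
      (by filter_upwards [hJ] with t ht using ht.2.symm)
  have hJae : ∀ᵐ t ∂volume.restrict (Set.Ioi (0 : ℝ)), J t < ⊤ := hJ.mono fun t ht ↦ ht.1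
  have hJfin : ∫⁻ t in Set.Ioi (0 : ℝ), J t ≠ ⊤ := by
    have := hJint.lintegral_lt_top
    rw [lintegral_congr_ae (g := J) (by
      filter_upwards [hJae] with t ht using ENNReal.ofReal_toReal ht.ne)] at this
    exact this.ne
  constructor
  · intro htop
    rw [hJt, htop] at hJfin
    exact hJfin (ENNReal.mul_top (by simpa using hΓ))
  · have h1 : ∫ t in Set.Ioi (0 : ℝ), (J t).toReal = ∫ t in Set.Ioi (0 : ℝ), ((I t).toReal -
        2 * π ^ (p + q) * ∫ r in Set.Ioi (0 : ℝ),
          (gaussianWeight p f r).toReal * parallelKernel p q r t) :=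
      integral_congr_ae (hJ.mono fun t ht ↦ ht.2)
    rw [integral_sub hIint (hFint.const_mul _), integral_const_mul,
      integral_toReal hJm.aemeasurable hJae, integral_toReal hIm.aemeasurable hIae, hIt, hJt,
      ENNReal.toReal_mul, ENNReal.toReal_mul, ENNReal.toReal_ofReal hΓ.le] at h1
    linarith

theorem lintegral_ball_rpow_norm {n : ℕ} (hn : 0 < n) {e ρ : ℝ} (he : 0 < n + e) (hρ : 0 < ρ) :
    ∫⁻ z in Metric.ball (0 : EuclideanSpace ℝ (Fin n)) ρ, ENNReal.ofReal (‖z‖ ^ e) =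
      ENNReal.ofReal (n * volume.real (Metric.ball (0 : EuclideanSpace ℝ (Fin n)) 1) / (n + e) *
        ρ ^ (n + e)) := by
  have : Nonempty (Fin n) := ⟨⟨0, hn⟩⟩
  have hcongr (y : ℝ) (hy : 0 < y) : y ^ (n - 1) • y ^ e = y ^ (n + e - 1) := by
    rw [smul_eq_mul, ← rpow_natCast, ← rpow_add hy, Nat.cast_sub hn]
    congr 1
    push_cast
    ring
  have hint : IntegrableOn (fun y : ℝ ↦ y ^ (n + e - 1)) (Set.Ioc 0 ρ) :=
    (intervalIntegrable_iff_integrableOn_Ioc_of_le hρ.le).1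
      (intervalIntegral.intervalIntegrable_rpow' (by linarith))
  have h1 : IntegrableOn (fun z : EuclideanSpace ℝ (Fin n) ↦ ‖z‖ ^ e) (Metric.ball 0 ρ) := by
    rw [integrableOn_fun_norm_addHaar volume (f := fun y ↦ y ^ e), finrank_euclideanSpace_fin]
    exact (hint.mono_set Set.Ioo_subset_Ioc_self).congr_fun
      (fun y hy ↦ (hcongr y hy.1).symm) measurableSet_Ioo
  rw [← ofReal_integral_eq_lintegral_ofReal h1 (.of_forall fun z ↦ by positivity),
    ← integral_indicator Metric.isOpen_ball.measurableSet]
  have h2 := integral_fun_norm_addHaar (volume : Measure (EuclideanSpace ℝ (Fin n)))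
    ((Set.Iio ρ).indicator fun y ↦ y ^ e)
  have h3 : (Metric.ball (0 : EuclideanSpace ℝ (Fin n)) ρ).indicator (fun z ↦ ‖z‖ ^ e) =
      fun z ↦ (Set.Iio ρ).indicator (fun y ↦ y ^ e) ‖z‖ := by
    ext z
    simp [Set.indicator]
  have h4 : ∫ y in Set.Ioi (0 : ℝ), y ^ (n - 1) • (Set.Iio ρ).indicator (fun y ↦ y ^ e) y =
      ρ ^ (n + e) / (n + e) := by
    have h5 : ∀ y ∈ Set.Ioi (0 : ℝ), y ^ (n - 1) • (Set.Iio ρ).indicator (fun y ↦ y ^ e) y =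
        (Set.Iio ρ).indicator (fun y ↦ y ^ (n + e - 1)) y := by
      intro y hy
      by_cases h : y < ρ
      · simpa [h] using hcongr y hy
      · simp [h]
    rw [setIntegral_congr_fun measurableSet_Ioi h5, integral_indicator measurableSet_Iio,
      Measure.restrict_restrict measurableSet_Iio, Set.Iio_inter_Ioi,
      ← integral_Ioc_eq_integral_Ioo, ← intervalIntegral.integral_of_le hρ.le,
      integral_rpow (.inl (by linarith)), sub_add_cancel, zero_rpow he.ne', sub_zero]
  rw [h3, h2, finrank_euclideanSpace_fin, h4, nsmul_eq_mul, smul_eq_mul]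
  congr 1
  ring

theorem abs_rpow_sub_rpow_le {s X Y : ℝ} (hX : 0 < X) (hY : 0 ≤ Y) (hYX : Y ≤ X)
    (hs : 0 < s) : |X ^ s - Y ^ s| ≤ max 1 s * X ^ (s - 1) * (X - Y) := by
  rw [abs_of_nonneg (sub_nonneg.2 (rpow_le_rpow hY hYX hs.le))]
  have hr0 : 0 ≤ Y / X := by positivity
  have hr1 : Y / X ≤ 1 := (div_le_one hX).2 hYX
  have key : 1 - (Y / X) ^ s ≤ max 1 s * (1 - Y / X) := by
    rcases le_total 1 s with h | h
    · rw [max_eq_right h]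
      have := one_add_mul_self_le_rpow_one_add (s := Y / X - 1) (by linarith) h
      rw [add_sub_cancel] at this
      linarith
    · rw [max_eq_left h]
      have := rpow_le_rpow_of_exponent_ge' hr0 hr1 hs.le h
      rw [rpow_one] at this
      linarith
  have e1 : X ^ s - Y ^ s = X ^ s * (1 - (Y / X) ^ s) := by
    rw [div_rpow hY hX.le]
    field_simp
  have e2 : max 1 s * X ^ (s - 1) * (X - Y) = X ^ s * (max 1 s * (1 - Y / X)) := by
    rw [rpow_sub_one hX.ne']
    field_simp
  rw [e1, e2]
  gcongr

theorem norm_rpow_smul_sub_le {E F : Type*} [NormedAddCommGroup E] [NormedAddCommGroup F]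
    [NormedSpace ℝ F] {ψ : E → F} {K : NNReal} {M R s : ℝ} (hK : LipschitzWith K ψ)
    (hM : ∀ x, ‖ψ x‖ ≤ M) (hs : 0 < s) {x y : E} (hx : x ≠ 0) (hyx : ‖y‖ ≤ ‖x‖) (hxR : ‖x‖ ≤ R) :
    ‖(‖x‖ ^ s : ℝ) • ψ x - (‖y‖ ^ s : ℝ) • ψ y‖ ≤
      (R * K + max 1 s * M) * ‖x‖ ^ (s - 1) * ‖x - y‖ := by
  have hX : 0 < ‖x‖ := norm_pos_iff.2 hx
  have hM0 : 0 ≤ M := (norm_nonneg _).trans (hM x)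
  have e : (‖x‖ ^ s : ℝ) • ψ x - (‖y‖ ^ s : ℝ) • ψ y =
      (‖x‖ ^ s : ℝ) • (ψ x - ψ y) + (‖x‖ ^ s - ‖y‖ ^ s : ℝ) • ψ y := by
    rw [smul_sub, sub_smul]; abel
  have h1 : ‖(‖x‖ ^ s : ℝ) • (ψ x - ψ y)‖ ≤ R * K * ‖x‖ ^ (s - 1) * ‖x - y‖ := by
    rw [norm_smul, norm_of_nonneg (by positivity)]
    calc ‖x‖ ^ s * ‖ψ x - ψ y‖ ≤ (‖x‖ * ‖x‖ ^ (s - 1)) * (K * ‖x - y‖) := by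
          rw [← rpow_one_add' hX.le (by linarith), add_sub_cancel]
          gcongr
          exact hK.norm_sub_le x y
      _ ≤ (R * ‖x‖ ^ (s - 1)) * (K * ‖x - y‖) := by gcongr
      _ = _ := by ring
  have h2 : ‖(‖x‖ ^ s - ‖y‖ ^ s : ℝ) • ψ y‖ ≤ max 1 s * M * ‖x‖ ^ (s - 1) * ‖x - y‖ := by
    rw [norm_smul, norm_eq_abs]
    calc |‖x‖ ^ s - ‖y‖ ^ s| * ‖ψ y‖ ≤ (max 1 s * ‖x‖ ^ (s - 1) * (‖x‖ - ‖y‖)) * M := by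
          gcongr
          · exact abs_rpow_sub_rpow_le hX (norm_nonneg y) hyx hs
          · exact hM y
      _ ≤ (max 1 s * ‖x‖ ^ (s - 1) * ‖x - y‖) * M := by
          gcongr
          exact norm_sub_norm_le x y
      _ = _ := by ring
  rw [e]
  refine (norm_add_le _ _).trans ((add_le_add h1 h2).trans_eq ?_)
  ring

theorem lintegral_sobolev_kernel_ne_top {n : ℕ} (hn : 0 < n) {a s C R : ℝ} (ha0 : 0 < a)
    (ha2 : a < 2) (hsa : a < n + 2 * s) (hR : 1 ≤ R) {f : EuclideanSpace ℝ (Fin n) → ℂ}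
    (hf : Measurable f) (hL2 : ∫⁻ x, ENNReal.ofReal (‖f x‖ ^ 2) ≠ ⊤)
    (hsupp : ∀ x, R < ‖x‖ → f x = 0)
    (hlip : ∀ x y, x ≠ 0 → ‖y‖ ≤ ‖x‖ → ‖x‖ ≤ 2 * R →
      ‖f x - f y‖ ≤ C * ‖x‖ ^ (s - 1) * ‖x - y‖) :
    ∫⁻ z : EuclideanSpace ℝ (Fin n) × EuclideanSpace ℝ (Fin n),
      ENNReal.ofReal (‖f z.1 - f z.2‖ ^ 2 / ‖z.1 - z.2‖ ^ (n + a)) ≠ ⊤ := by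
  set A : Set (EuclideanSpace ℝ (Fin n) × EuclideanSpace ℝ (Fin n)) := {z | ‖z.2‖ ≤ ‖z.1‖}
  have hA : MeasurableSet A := measurableSet_le (by fun_prop) (by fun_prop)
  set G : EuclideanSpace ℝ (Fin n) × EuclideanSpace ℝ (Fin n) → ENNReal := fun z ↦
    ENNReal.ofReal (‖f z.1 - f z.2‖ ^ 2 / ‖z.1 - z.2‖ ^ (n + a))
  have hG : Measurable G := by fun_prop
  have hGswap (z) : G z.swap = G z := by
    simp only [G, Prod.fst_swap, Prod.snd_swap]
    rw [norm_sub_rev (f z.2), norm_sub_rev z.2]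
  have hle : ∫⁻ z, G z ≤ 2 * ∫⁻ x, ∫⁻ y, A.indicator G (x, y) := by
    rw [← lintegral_prod_add_swap (hG.indicator hA), ← Measure.volume_eq_prod]
    refine lintegral_mono fun z ↦ ?_
    rcases le_total ‖z.2‖ ‖z.1‖ with h | h
    · refine le_trans (le_of_eq ?_) le_self_add
      rw [Set.indicator_of_mem (show z ∈ A from h)]
    · refine le_trans (le_of_eq ?_) le_add_self
      rw [Set.indicator_of_mem (show z.swap ∈ A from h), hGswap]
  set c : ℝ := n * volume.real (Metric.ball (0 : EuclideanSpace ℝ (Fin n)) 1) / (n + (2 - n - a))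
  have hc : 0 ≤ c := div_nonneg (by positivity) (by linarith)
  have hin : ∀ᵐ x : EuclideanSpace ℝ (Fin n), ∫⁻ y, A.indicator G (x, y) ≤
      ENNReal.ofReal (C ^ 2 * (c * 3 ^ (2 - a))) *
        (Metric.ball (0 : EuclideanSpace ℝ (Fin n)) (2 * R + 1)).indicator
          (fun x ↦ ENNReal.ofReal (‖x‖ ^ (2 * s - a))) x +
      ENNReal.ofReal (4 ^ (n + a)) * (∫⁻ y, ENNReal.ofReal (‖f y‖ ^ 2)) *
        ENNReal.ofReal ((1 + ‖x‖) ^ (-(n + a))) := by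
    filter_upwards [ae_ne_zero hn] with x hx
    have hX : 0 < ‖x‖ := norm_pos_iff.2 hx
    rcases le_or_gt ‖x‖ (2 * R) with hxR | hxR
    · refine le_trans ?_ le_self_add
      rw [Set.indicator_of_mem (by rw [mem_ball_zero_iff]; linarith)]
      have hpt : ∀ y, A.indicator G (x, y) ≤ ENNReal.ofReal (C ^ 2 * ‖x‖ ^ (2 * s - 2)) *
          (Metric.ball (0 : EuclideanSpace ℝ (Fin n)) (3 * ‖x‖)).indicator
            (fun z ↦ ENNReal.ofReal (‖z‖ ^ (2 - n - a))) (x - y) := by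
        intro y
        by_cases hy : ‖y‖ ≤ ‖x‖
        · have hmem : x - y ∈ Metric.ball (0 : EuclideanSpace ℝ (Fin n)) (3 * ‖x‖) := by
            rw [mem_ball_zero_iff]
            linarith [norm_sub_le x y]
          rw [Set.indicator_of_mem (show (x, y) ∈ A from hy), Set.indicator_of_mem hmem,
            ← ENNReal.ofReal_mul (by positivity)]
          refine ENNReal.ofReal_le_ofReal ?_
          rcases eq_or_ne x y with rfl | hxy
          · simp only [sub_self, norm_zero]
            norm_num
            positivity
          have hz : 0 < ‖x - y‖ := norm_pos_iff.2 (sub_ne_zero.2 hxy)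
          rw [div_le_iff₀ (by positivity)]
          calc ‖f x - f y‖ ^ 2 ≤ (C * ‖x‖ ^ (s - 1) * ‖x - y‖) ^ 2 := by
                gcongr
                exact hlip x y hx hy hxR
            _ = C ^ 2 * (‖x‖ ^ (s - 1)) ^ 2 * ‖x - y‖ ^ 2 := by ring
            _ = _ := by
                rw [mul_assoc _ (‖x - y‖ ^ _), ← rpow_add hz, ← rpow_natCast (‖x‖ ^ (s - 1)),
                  ← rpow_mul hX.le, ← rpow_natCast ‖x - y‖]
                congr 2
                · congr 1; push_cast; ring
                · push_cast; ring
        · rw [Set.indicator_of_notMem (show (x, y) ∉ A from hy)]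
          exact zero_le
      refine (lintegral_mono hpt).trans_eq ?_
      rw [lintegral_const_mul' _ _ ENNReal.ofReal_ne_top,
        lintegral_sub_left_eq_self (fun z ↦
          (Metric.ball (0 : EuclideanSpace ℝ (Fin n)) (3 * ‖x‖)).indicator
            (fun z ↦ ENNReal.ofReal (‖z‖ ^ (2 - n - a))) z),
        lintegral_indicator Metric.isOpen_ball.measurableSet,
        lintegral_ball_rpow_norm hn (by linarith) (by positivity),
        ← ENNReal.ofReal_mul (by positivity), ← ENNReal.ofReal_mul (by positivity)]
      congr 1
      rw [show (n : ℝ) + (2 - n - a) = 2 - a by ring, mul_rpow (by norm_num) hX.le,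
        show 2 * s - a = (2 * s - 2) + (2 - a) by ring, rpow_add hX]
      simp only [c]
      rw [show (n : ℝ) + (2 - n - a) = 2 - a by ring]
      ring
    · refine le_trans ?_ le_add_self
      have hpt : ∀ y, A.indicator G (x, y) ≤
          ENNReal.ofReal (4 ^ (n + a) * (1 + ‖x‖) ^ (-(n + a))) * ENNReal.ofReal (‖f y‖ ^ 2) := by
        intro y
        refine (Set.indicator_le_self _ _ _).trans ?_
        rw [← ENNReal.ofReal_mul (by positivity)]
        refine ENNReal.ofReal_le_ofReal ?_
        simp only
        rw [hsupp x (by linarith), zero_sub, norm_neg]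
        rcases le_or_gt ‖y‖ R with hy | hy
        · have hd : (1 + ‖x‖) / 4 ≤ ‖x - y‖ := by linarith [norm_sub_norm_le x y]
          have hd' : 4 ^ (n + a) * (1 + ‖x‖) ^ (-(n + a)) = 1 / ((1 + ‖x‖) / 4) ^ (n + a) := by
            rw [div_rpow (by positivity) (by norm_num), rpow_neg (by positivity)]
            field_simp
          rw [hd', one_div, mul_comm, ← div_eq_mul_inv]
          gcongr
        · rw [hsupp y hy]
          simp
      refine (lintegral_mono hpt).trans_eq ?_
      rw [lintegral_const_mul' _ _ ENNReal.ofReal_ne_top, ENNReal.ofReal_mul (by positivity)]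
      ring
  have hball := lintegral_ball_rpow_norm hn (e := 2 * s - a) (ρ := 2 * R + 1)
    (by linarith) (by linarith)
  have htail : ∫⁻ x : EuclideanSpace ℝ (Fin n),
      ENNReal.ofReal ((1 + ‖x‖) ^ (-(n + a))) < ⊤ := by
    refine finite_integral_one_add_norm ?_
    rw [finrank_euclideanSpace_fin]
    linarith
  refine ne_top_of_le_ne_top (ENNReal.mul_ne_top (by simp) ?_) hle
  refine ne_top_of_le_ne_top ?_ (lintegral_mono_ae hin)
  rw [lintegral_add_right _ (by fun_prop), lintegral_const_mul' _ _ ENNReal.ofReal_ne_top,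
    lintegral_indicator Metric.isOpen_ball.measurableSet, hball,
    lintegral_const_mul' _ _ (ENNReal.mul_ne_top ENNReal.ofReal_ne_top hL2)]
  exact ENNReal.add_ne_top.2 ⟨ENNReal.mul_ne_top ENNReal.ofReal_ne_top ENNReal.ofReal_ne_top,
    ENNReal.mul_ne_top (ENNReal.mul_ne_top ENNReal.ofReal_ne_top hL2) htail.ne⟩

theorem integral_integral_eq_toReal_lintegral_prod {α : Type*} [MeasurableSpace α]
    {μ : Measure α} [SFinite μ] {g : α × α → ℝ} (hg : Measurable g) (h0 : 0 ≤ g)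
    (hfin : ∫⁻ z, ENNReal.ofReal (g z) ∂(μ.prod μ) ≠ ⊤) :
    ∫ x, ∫ y, g (x, y) ∂μ ∂μ = (∫⁻ z, ENNReal.ofReal (g z) ∂(μ.prod μ)).toReal := by
  have hint : Integrable g (μ.prod μ) :=
    ⟨hg.aestronglyMeasurable, by
      rw [hasFiniteIntegral_iff_ofReal (.of_forall h0)]
      exact hfin.lt_top⟩
  rw [← integral_eq_lintegral_of_nonneg_ae (.of_forall h0) hg.aestronglyMeasurable,
    integral_prod _ hint]

theorem lintegral_rpow_norm_mul_sq_norm_ne_top {n : ℕ} (hn : 0 < n) {e M R : ℝ}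
    (he : 0 < n + e) (hR : 0 < R) {ψ : EuclideanSpace ℝ (Fin n) → ℂ} (hM : ∀ x, ‖ψ x‖ ≤ M)
    (hψ : ∀ x, R ≤ ‖x‖ → ψ x = 0) :
    ∫⁻ x, ENNReal.ofReal (‖x‖ ^ e * ‖ψ x‖ ^ 2) ≠ ⊤ := by
  have hpt : ∀ x, ENNReal.ofReal (‖x‖ ^ e * ‖ψ x‖ ^ 2) ≤ ENNReal.ofReal (M ^ 2) *
      (Metric.ball (0 : EuclideanSpace ℝ (Fin n)) R).indicator
        (fun z ↦ ENNReal.ofReal (‖z‖ ^ e)) x := by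
    intro x
    rcases lt_or_ge ‖x‖ R with h | h
    · rw [Set.indicator_of_mem (mem_ball_zero_iff.2 h), ← ENNReal.ofReal_mul (by positivity),
        mul_comm]
      gcongr
      exact hM x
    · simp [hψ x h]
  refine ne_top_of_le_ne_top ?_ (lintegral_mono hpt)
  rw [lintegral_const_mul' _ _ ENNReal.ofReal_ne_top,
    lintegral_indicator Metric.isOpen_ball.measurableSet, lintegral_ball_rpow_norm hn he hR]
  exact ENNReal.mul_ne_top ENNReal.ofReal_ne_top ENNReal.ofReal_ne_top

theorem alphaConst_mul_eq {n : ℕ} {a I H J : ℝ} (ha : a ∈ Set.Ioo (0 : ℝ) 2)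
    (h : Real.Gamma ((n + a) / 2) * I = 2 * π ^ ((n : ℝ) / 2) *
      (Real.Gamma ((n + a) / 4) / Real.Gamma ((n - a) / 4) * H *
        (Real.Gamma ((n + a) / 4) * Real.Gamma (1 - a / 2) /
          (a / 2 * Real.Gamma ((n - a) / 4)))) + Real.Gamma ((n + a) / 2) * J) :
    alphaConst n a * I = 2 ^ a * (Real.Gamma ((n + a) / 4) / Real.Gamma ((n - a) / 4)) ^ 2 * H +
      alphaConst n a * J := by
  obtain ⟨ha0, ha2⟩ := ha
  have hpos : 0 < Real.Gamma (1 - a / 2) := Real.Gamma_pos_of_pos (by linarith)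
  have hG : |Real.Gamma (-a / 2)| = Real.Gamma (1 - a / 2) / (a / 2) := by
    have := Real.Gamma_add_one (s := -a / 2) (by linarith)
    rw [show -a / 2 + 1 = 1 - a / 2 by ring] at this
    have h2 : Real.Gamma (-a / 2) = -(Real.Gamma (1 - a / 2) / (a / 2)) := by
      rw [this]; field_simp
    rw [h2, abs_neg, abs_of_pos (by positivity)]
  have hπ : π ^ (-(n : ℝ) / 2) * π ^ ((n : ℝ) / 2) = 1 := by
    rw [← rpow_add pi_pos, neg_div, neg_add_cancel, rpow_zero]
  have h2a : (2 : ℝ) ^ a = 2 ^ (a - 1) * 2 := by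
    rw [rpow_sub_one two_ne_zero]; ring
  calc alphaConst n a * I
      = 2 ^ (a - 1) * π ^ (-(n : ℝ) / 2) / |Real.Gamma (-a / 2)| *
          (Real.Gamma ((n + a) / 2) * I) := by
        rw [alphaConst]; ring
    _ = 2 ^ (a - 1) * 2 * (π ^ (-(n : ℝ) / 2) * π ^ ((n : ℝ) / 2)) *
          (Real.Gamma ((n + a) / 4) / Real.Gamma ((n - a) / 4)) ^ 2 * H *
          (Real.Gamma (1 - a / 2) / (a / 2) / |Real.Gamma (-a / 2)|) +
          alphaConst n a * J := by
        rw [h, alphaConst]; ring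
    _ = _ := by
        rw [hπ, ← h2a, hG, div_self (by positivity)]; ring

/-- Ground state representation of `|q|^{b/2}|p|^a|q|^{b/2}`. -/
theorem weighted_ground_state_representation
    (n : ℕ) (hn : 0 < n) (a b : ℝ) (ha : a ∈ Set.Ioo (0 : ℝ) 2) (hb : 0 < b)
    (hab : a + b < (n : ℝ)) (γ : ℝ) (hγ : γ = ((n : ℝ) + b - a) / 2)
    (ψ : EuclideanSpace ℝ (Fin n) → ℂ)
    (hsmooth : ContDiff ℝ (⊤ : ℕ∞) ψ) (hsupp : HasCompactSupport ψ) :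
    alphaConst n a *
        ∫ x : EuclideanSpace ℝ (Fin n), ∫ y : EuclideanSpace ℝ (Fin n),
          ‖(‖x‖ ^ (b / 2) : ℝ) • ψ x - (‖y‖ ^ (b / 2) : ℝ) • ψ y‖ ^ 2 /
            ‖x - y‖ ^ ((n : ℝ) + a) =
      2 ^ a * (Real.Gamma (((n : ℝ) + a) / 4) / Real.Gamma (((n : ℝ) - a) / 4)) ^ 2 *
          (∫ x : EuclideanSpace ℝ (Fin n), ‖x‖ ^ (b - a) * ‖ψ x‖ ^ 2) +
        alphaConst n a *
          ∫ x : EuclideanSpace ℝ (Fin n), ∫ y : EuclideanSpace ℝ (Fin n),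
            ‖x‖ ^ (b / 2) * ‖y‖ ^ (b / 2) *
              ‖(‖x‖ ^ γ : ℝ) • ψ x - (‖y‖ ^ γ : ℝ) • ψ y‖ ^ 2 /
              (‖x‖ ^ γ * ‖x - y‖ ^ ((n : ℝ) + a) * ‖y‖ ^ γ) := by
  obtain ⟨ha0, ha2⟩ := id ha
  obtain ⟨K, hK⟩ := hsmooth.lipschitzWith_of_hasCompactSupport hsupp (by simp)
  obtain ⟨M, hM⟩ := hsupp.exists_bound_of_continuous hsmooth.continuous
  obtain ⟨R, hR, hψ⟩ : ∃ R : ℝ, 1 ≤ R ∧ ∀ x, R ≤ ‖x‖ → ψ x = 0 := by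
    obtain ⟨r, hr⟩ := hsupp.isCompact.isBounded.exists_norm_le
    refine ⟨max 1 (r + 1), le_max_left _ _, fun x hx ↦ ?_⟩
    by_contra hne
    linarith [hr x (subset_tsupport ψ hne), le_max_right 1 (r + 1)]
  have hψm : Measurable ψ := hsmooth.continuous.measurable
  set f : EuclideanSpace ℝ (Fin n) → ℂ := fun x ↦ (‖x‖ ^ (b / 2) : ℝ) • ψ x with hf_def
  have hf : Measurable f := by fun_prop
  have hfsq (x) : ‖f x‖ ^ 2 = ‖x‖ ^ b * ‖ψ x‖ ^ 2 := by
    rw [hf_def, norm_smul, norm_of_nonneg (by positivity), mul_pow, ← rpow_natCast (‖x‖ ^ _),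
      ← rpow_mul (norm_nonneg x)]
    congr 2
    push_cast
    ring
  have hL2 : ∫⁻ x, ENNReal.ofReal (‖f x‖ ^ 2) ≠ ⊤ := by
    simp_rw [hfsq]
    exact lintegral_rpow_norm_mul_sq_norm_ne_top hn (by positivity) (by linarith) hM hψ
  have hne := ae_ne_zero hn
  have hHeq : ∫⁻ x, ENNReal.ofReal (‖x‖ ^ (-a) * ‖f x‖ ^ 2) =
      ∫⁻ x, ENNReal.ofReal (‖x‖ ^ (b - a) * ‖ψ x‖ ^ 2) := by
    refine lintegral_congr_ae ?_
    filter_upwards [hne] with x hx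
    rw [hfsq, ← mul_assoc, ← rpow_add (norm_pos_iff.2 hx), neg_add_eq_sub]
  have hH : ∫⁻ x, ENNReal.ofReal (‖x‖ ^ (b - a) * ‖ψ x‖ ^ 2) ≠ ⊤ :=
    lintegral_rpow_norm_mul_sq_norm_ne_top hn (by linarith) (by linarith) hM hψ
  have hI := lintegral_sobolev_kernel_ne_top hn (s := b / 2) ha0 ha2 (by linarith) hR hf hL2
    (fun x hx ↦ by simp [hf_def, hψ x hx.le])
    (fun x y hx hyx hxR ↦ norm_rpow_smul_sub_le hK hM (by positivity) hx hyx hxR)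
  have e1 : 2 * (((n : ℝ) + a) / 4 - ((n : ℝ) - a) / 4) = a := by ring
  have e2 : 4 * (((n : ℝ) + a) / 4) = n + a := by ring
  have e3 : 2 * (((n : ℝ) + a) / 4) = (n + a) / 2 := by ring
  have e4 : ((n : ℝ) - a) / 4 + (n + a) / 4 = n / 2 := by ring
  have e5 : 1 + ((n : ℝ) - a) / 4 - (n + a) / 4 = 1 - a / 2 := by ring
  have e6 : ((n : ℝ) + a) / 4 - (n - a) / 4 = a / 2 := by ring
  have e7 : 2 * (((n : ℝ) - a) / 4) = (n - a) / 2 := by ring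
  have hrep := ground_state_representation_of_finite hn (p := (n - a) / 4) (q := (n + a) / 4)
    (by linarith) (by linarith) (by linarith) e4 hf (by rwa [e2]) hL2
    (by rwa [e1, hHeq])
  rw [e1, e2, e3, e4, e5, e6, e7, hHeq] at hrep
  obtain ⟨hJ, hrep⟩ := hrep
  have hγ' : γ = (n - a) / 2 + b / 2 := by rw [hγ]; ring
  have hJeq : ∫⁻ z : EuclideanSpace ℝ (Fin n) × EuclideanSpace ℝ (Fin n), ENNReal.ofReal
        (‖z.1‖ ^ (-((n - a) / 2)) * ‖z.2‖ ^ (-((n - a) / 2)) *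
          ‖(‖z.1‖ ^ ((n - a) / 2) : ℝ) • f z.1 - (‖z.2‖ ^ ((n - a) / 2) : ℝ) • f z.2‖ ^ 2 /
          ‖z.1 - z.2‖ ^ (n + a)) =
      ∫⁻ z : EuclideanSpace ℝ (Fin n) × EuclideanSpace ℝ (Fin n), ENNReal.ofReal
        (‖z.1‖ ^ (b / 2) * ‖z.2‖ ^ (b / 2) *
          ‖(‖z.1‖ ^ γ : ℝ) • ψ z.1 - (‖z.2‖ ^ γ : ℝ) • ψ z.2‖ ^ 2 /
          (‖z.1‖ ^ γ * ‖z.1 - z.2‖ ^ ((n : ℝ) + a) * ‖z.2‖ ^ γ)) := by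
    refine lintegral_congr_ae ?_
    filter_upwards [Measure.quasiMeasurePreserving_fst.ae hne,
      Measure.quasiMeasurePreserving_snd.ae hne] with z hz1 hz2
    have hsm (x : EuclideanSpace ℝ (Fin n)) (hx : x ≠ 0) :
        (‖x‖ ^ ((n - a) / 2) : ℝ) • f x = (‖x‖ ^ γ : ℝ) • ψ x := by
      rw [hf_def, smul_smul, ← rpow_add (norm_pos_iff.2 hx), hγ']
    have hw (x : EuclideanSpace ℝ (Fin n)) (hx : x ≠ 0) :
        ‖x‖ ^ (-((n - a) / 2)) = ‖x‖ ^ (b / 2) / ‖x‖ ^ γ := by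
      rw [← rpow_sub (norm_pos_iff.2 hx), hγ']
      congr 1
      ring
    rw [hsm _ hz1, hsm _ hz2, hw _ hz1, hw _ hz2]
    congr 1
    simp only [div_eq_mul_inv, mul_inv]
    ring
  rw [hJeq] at hJ hrep
  have hIint := integral_integral_eq_toReal_lintegral_prod
    (g := fun z : EuclideanSpace ℝ (Fin n) × EuclideanSpace ℝ (Fin n) ↦
      ‖f z.1 - f z.2‖ ^ 2 / ‖z.1 - z.2‖ ^ (n + a)) (by fun_prop) (fun z ↦ by positivity) hI
  have hJint := integral_integral_eq_toReal_lintegral_prod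
    (g := fun z : EuclideanSpace ℝ (Fin n) × EuclideanSpace ℝ (Fin n) ↦
      ‖z.1‖ ^ (b / 2) * ‖z.2‖ ^ (b / 2) *
        ‖(‖z.1‖ ^ γ : ℝ) • ψ z.1 - (‖z.2‖ ^ γ : ℝ) • ψ z.2‖ ^ 2 /
        (‖z.1‖ ^ γ * ‖z.1 - z.2‖ ^ ((n : ℝ) + a) * ‖z.2‖ ^ γ))
    (by fun_prop) (fun z ↦ by positivity) hJ
  have hHint : ∫ x : EuclideanSpace ℝ (Fin n), ‖x‖ ^ (b - a) * ‖ψ x‖ ^ 2 =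
      (∫⁻ x, ENNReal.ofReal (‖x‖ ^ (b - a) * ‖ψ x‖ ^ 2)).toReal :=
    integral_eq_lintegral_of_nonneg_ae (.of_forall fun x ↦ by positivity)
      (by fun_prop : Measurable _).aestronglyMeasurable
  refine alphaConst_mul_eq ha ?_
  rw [hIint, hJint, hHint]
  exact hrep
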